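/- Let A be a commutative ring, R = A[x11,x12,x21,x22]/(x11*x22 - x12*x21 - 1), I1 = (x12,x21), I2 = (x11,x22), and I = I1*I2. Then there is an isomorphism of A-algebras R/I ≅ A[t,t⁻¹] × (A[u,v]/(u*v + 1)), where t, 1/t, u, v are the images of x11, x22, x12, x21 respectively. -/

import Mathlib

theorem sl2aux_bij {A S L Q : Type*} [CommRing A] [CommRing S] [CommRing L] [CommRing Q]
    [Algebra A S] [Algebra A L] [Algebra A Q] (F1 : S →ₐ[A] L) (F2 : S →ₐ[A] Q)
    (G1 : L →ₐ[A] S) (G2 : Q →ₐ[A] S) (e f : S) (hef : e + f = 1)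
    (h1e : F1 e = 1) (h2e : F2 e = 0) (h1f : F1 f = 0) (h2f : F2 f = 1)
    (h1 : F1.comp G1 = AlgHom.id A L) (h2 : F2.comp G2 = AlgHom.id A Q)
    (k1 : ∀ s, e * G1 (F1 s) = e * s) (k2 : ∀ s, f * G2 (F2 s) = f * s) :
    Function.Bijective (F1.prod F2) := by
  constructor
  · rw [injective_iff_map_eq_zero]
    intro s hs
    have a1 : F1 s = 0 := congrArg Prod.fst hs
    have a2 : F2 s = 0 := congrArg Prod.snd hs
    have b1 := k1 s
    have b2 := k2 s
    rw [a1, map_zero] at b1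
    rw [a2, map_zero] at b2
    linear_combination (-s) * hef - b1 - b2
  · rintro ⟨p, q⟩
    refine ⟨e * G1 p + f * G2 q, ?_⟩
    have c1 : F1 (G1 p) = p := DFunLike.congr_fun h1 p
    have c2 : F2 (G2 q) = q := DFunLike.congr_fun h2 q
    ext
    · simp [h1e, h1f, c1]
    · simp [h2e, h2f, c2]

theorem sl2aux_ind {A S σ : Type*} [CommRing A] [CommRing S] [Algebra A S]
    (π : MvPolynomial σ A →ₐ[A] S) (hπ : Function.Surjective π) (H : S →ₐ[A] S) (e : S)
    (h : ∀ i, e * H (π (MvPolynomial.X i)) = e * π (MvPolynomial.X i)) (s : S) :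
    e * H s = e * s := by
  obtain ⟨p, rfl⟩ := hπ s
  induction p using MvPolynomial.induction_on with
  | C a =>
    have : (MvPolynomial.C a : MvPolynomial σ A) = algebraMap A _ a := rfl
    rw [this, AlgHom.commutes, AlgHom.commutes]
  | add p q hp hq => simp only [map_add, mul_add, hp, hq]
  | mul_X p i hp =>
    rw [map_mul, map_mul]
    linear_combination H (π (MvPolynomial.X i)) * hp + π p * h i

theorem sl2aux_laurent {A S : Type*} [CommRing A] [CommRing S] [Algebra A S] (u : Sˣ) :
    ∃ G : LaurentPolynomial A →ₐ[A] S, G (LaurentPolynomial.T 1) = u ∧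
      G (LaurentPolynomial.T (-1)) = (u⁻¹ : Sˣ) := by
  refine ⟨AddMonoidAlgebra.lift A S ℤ ((Units.coeHom S).comp (zpowersHom Sˣ u)), ?_, ?_⟩
  · rw [LaurentPolynomial.T, AddMonoidAlgebra.lift_single]; simp
  · rw [LaurentPolynomial.T, AddMonoidAlgebra.lift_single]; simp

set_option maxHeartbeats 2000000 in
open MvPolynomial in
/-- For `R = A[x11,x12,x21,x22]/(x11*x22 - x12*x21 - 1)`, `I1 = (x12,x21)`,
`I2 = (x11,x22)` and `I = I1*I2`, there is an isomorphism of `A`-algebras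
`R/I ≅ A[t,t⁻¹] × A[u,v]/(uv+1)` sending the classes of `x11, x22, x12, x21`
to `t, t⁻¹, u, v` respectively. -/
theorem sl2_normalizer_coordinate_ring (A : Type) [CommRing A] :
    let P := MvPolynomial (Fin 2 × Fin 2) A
    let rel : P := X (0, 0) * X (1, 1) - X (0, 1) * X (1, 0) - 1
    let R := P ⧸ Ideal.span {rel}
    let mk : P →+* R := Ideal.Quotient.mk (Ideal.span {rel})
    let I1 : Ideal R := Ideal.span {mk (X (0, 1)), mk (X (1, 0))}
    let I2 : Ideal R := Ideal.span {mk (X (0, 0)), mk (X (1, 1))}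
    let I : Ideal R := I1 * I2
    let Q2 := MvPolynomial (Fin 2) A ⧸
      Ideal.span {(X 0 * X 1 + 1 : MvPolynomial (Fin 2) A)}
    let mk2 : MvPolynomial (Fin 2) A →+* Q2 :=
      Ideal.Quotient.mk (Ideal.span {(X 0 * X 1 + 1 : MvPolynomial (Fin 2) A)})
    let mkI : R →+* R ⧸ I := Ideal.Quotient.mk I
    ∃ φ : (R ⧸ I) ≃ₐ[A] LaurentPolynomial A × Q2,
      φ (mkI (mk (X (0, 0)))) = (LaurentPolynomial.T 1, 0) ∧
      φ (mkI (mk (X (1, 1)))) = (LaurentPolynomial.T (-1), 0) ∧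
      φ (mkI (mk (X (0, 1)))) = (0, mk2 (X 0)) ∧
      φ (mkI (mk (X (1, 0)))) = (0, mk2 (X 1)) := by
  intro P rel R mk I1 I2 I Q2 mk2 mkI
  let π : P →ₐ[A] (R ⧸ I) :=
    (Ideal.Quotient.mkₐ A I).comp (Ideal.Quotient.mkₐ A (Ideal.span {rel}))
  have hπ : Function.Surjective π :=
    (Ideal.Quotient.mkₐ_surjective A I).comp (Ideal.Quotient.mkₐ_surjective A _)
  have hX : ∀ p : P, mkI (mk p) = π p := fun _ => rfl
  let τ : MvPolynomial (Fin 2) A →ₐ[A] Q2 := Ideal.Quotient.mkₐ A _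
  have hτ : ∀ p, mk2 p = τ p := fun _ => rfl
  have huv : τ (X 0) * τ (X 1) = -1 := by
    have : τ (X 0 * X 1 + 1) = 0 :=
      Ideal.Quotient.eq_zero_iff_mem.2 (Ideal.subset_span rfl)
    rw [map_add, map_mul, map_one] at this
    linear_combination this
  have hrel : π (X (0, 0)) * π (X (1, 1)) - π (X (0, 1)) * π (X (1, 0)) = 1 := by
    have h0 : mk rel = 0 := Ideal.Quotient.eq_zero_iff_mem.2 (Ideal.subset_span rfl)
    have : π rel = 0 := by rw [← hX, h0, map_zero]
    simp only [rel, map_sub, map_mul, map_one] at this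
    linear_combination this
  have hI : ∀ p q : P, mk p ∈ I1 → mk q ∈ I2 → π p * π q = 0 := by
    intro p q hp hq
    rw [← hX, ← hX, ← map_mul]
    exact Ideal.Quotient.eq_zero_iff_mem.2 (Ideal.mul_mem_mul hp hq)
  have m01 : mk (X (0, 1)) ∈ I1 := Ideal.subset_span (by simp)
  have m10 : mk (X (1, 0)) ∈ I1 := Ideal.subset_span (by simp)
  have m00 : mk (X (0, 0)) ∈ I2 := Ideal.subset_span (by simp)
  have m11 : mk (X (1, 1)) ∈ I2 := Ideal.subset_span (by simp)
  have hba := hI _ _ m01 m00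
  have hbd := hI _ _ m01 m11
  have hca := hI _ _ m10 m00
  have hcd := hI _ _ m10 m11
  simp only [hX, hτ]
  -- forward maps
  have lift : ∀ (B : Type) [CommRing B] [Algebra A B] (a b c d : B), a * d - b * c = 1 →
      b * a = 0 → b * d = 0 → c * a = 0 → c * d = 0 →
      ∃ F : (R ⧸ I) →ₐ[A] B, F (π (X (0, 0))) = a ∧ F (π (X (0, 1))) = b ∧
        F (π (X (1, 0))) = c ∧ F (π (X (1, 1))) = d := by
    intro B _ _ a b c d h hba hbd hca hcd
    let ev : P →ₐ[A] B := aeval (fun i : Fin 2 × Fin 2 => !![a, b; c, d] i.1 i.2)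
    have e00 : ev (X (0, 0)) = a := aeval_X _ _
    have e01 : ev (X (0, 1)) = b := aeval_X _ _
    have e10 : ev (X (1, 0)) = c := aeval_X _ _
    have e11 : ev (X (1, 1)) = d := aeval_X _ _
    have hk : ∀ p ∈ Ideal.span {rel}, ev p = 0 := by
      have : Ideal.span {rel} ≤ RingHom.ker ev := by
        rw [Ideal.span_le, Set.singleton_subset_iff]
        change ev rel = 0
        simp only [rel, map_sub, map_mul, map_one, e00, e01, e10, e11]
        linear_combination h
      exact this
    let E : R →ₐ[A] B := Ideal.Quotient.liftₐ (Ideal.span {rel}) ev hk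
    have hE : ∀ p, E (mk p) = ev p := fun p => rfl
    have hk2 : ∀ r ∈ I, E r = 0 := by
      have : I ≤ RingHom.ker E := by
        simp only [I, I1, I2]
        rw [Ideal.span_mul_span', Ideal.span_le]
        rintro _ ⟨x, hx, y, hy, rfl⟩
        change E (x * y) = 0
        rw [map_mul]
        rcases hx with rfl | rfl <;> rcases hy with rfl | rfl <;>
          simp only [hE, e00, e01, e10, e11, hba, hbd, hca, hcd]
      exact this
    exact ⟨Ideal.Quotient.liftₐ I E hk2, e00, e01, e10, e11⟩
  obtain ⟨F1, f1a, f1b, f1c, f1d⟩ := lift (LaurentPolynomial A) (LaurentPolynomial.T 1) 0 0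
    (LaurentPolynomial.T (-1)) (by rw [← LaurentPolynomial.T_add]; simp) (by simp) (by simp)
    (by simp) (by simp)
  obtain ⟨F2, f2a, f2b, f2c, f2d⟩ := lift Q2 0 (τ (X 0)) (τ (X 1)) 0
    (by rw [huv]; simp) (by simp) (by simp) (by simp) (by simp)
  clear lift
  clear_value π τ
  generalize ha : π (X (0, 0)) = a at *
  generalize hb : π (X (0, 1)) = b at *
  generalize hc : π (X (1, 0)) = c at *
  generalize hd : π (X (1, 1)) = d at *
  obtain ⟨G1, g1t, g1s⟩ := sl2aux_laurent (A := A) (S := R ⧸ I)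
    ⟨a - b * c, d - b * c, by
      linear_combination hrel - (b * c) * hrel + (b * d) * hca - b * hca - b * hcd, by
      linear_combination hrel - (b * c) * hrel + (b * d) * hca - b * hca - b * hcd⟩
  have hτk : ∀ p ∈ Ideal.span {(X 0 * X 1 + 1 : MvPolynomial (Fin 2) A)},
      (aeval ![b + a * d, c - a * d] : MvPolynomial (Fin 2) A →ₐ[A] R ⧸ I) p = 0 := by
    have : Ideal.span {(X 0 * X 1 + 1 : MvPolynomial (Fin 2) A)} ≤ RingHom.ker
        (aeval ![b + a * d, c - a * d] : MvPolynomial (Fin 2) A →ₐ[A] R ⧸ I) := by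
      rw [Ideal.span_le, Set.singleton_subset_iff, SetLike.mem_coe, RingHom.mem_ker]
      simp only [map_add, map_mul, map_one, aeval_X, Matrix.cons_val_zero, Matrix.cons_val_one]
      linear_combination -(1 + a * d) * hrel - (b * d) * hca - d * hba + d * hca
    exact this
  let G2 : Q2 →ₐ[A] R ⧸ I := Ideal.Quotient.liftₐ _ _ hτk
  have g2u : G2 (τ (X 0)) = b + a * d := by
    rw [← hτ]; exact aeval_X _ _
  have g2v : G2 (τ (X 1)) = c - a * d := by
    rw [← hτ]; exact aeval_X _ _
  clear_value G2
  have hTT : (LaurentPolynomial.T 1 * LaurentPolynomial.T (-1) : LaurentPolynomial A) = 1 := by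
    rw [← LaurentPolynomial.T_add]; simp
  have hbij : Function.Bijective (F1.prod F2) := by
    apply sl2aux_bij F1 F2 G1 G2 (a * d) (-(b * c))
    · linear_combination hrel
    · rw [map_mul, f1a, f1d, hTT]
    · rw [map_mul, f2a, zero_mul]
    · rw [map_neg, map_mul, f1b, zero_mul, neg_zero]
    · rw [map_neg, map_mul, f2b, f2c, huv, neg_neg]
    · apply AddMonoidAlgebra.algHom_ext'
      · apply MonoidHom.ext_mint
        change F1 (G1 (LaurentPolynomial.T 1)) = LaurentPolynomial.T 1
        rw [g1t]
        simp [f1a, f1b]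
      · exact Subsingleton.elim _ _
    · apply Ideal.Quotient.algHom_ext
      apply MvPolynomial.algHom_ext
      intro i
      change F2 (G2 (mk2 (X i))) = mk2 (X i)
      rw [hτ]
      fin_cases i
      · change F2 (G2 (τ (X 0))) = τ (X 0)
        simp [g2u, f2b, f2a]
      · change F2 (G2 (τ (X 1))) = τ (X 1)
        simp [g2v, f2c, f2a]
    · refine sl2aux_ind (A := A) (S := R ⧸ I) π hπ (G1.comp F1) (a * d) ?_
      rintro ⟨i, j⟩
      fin_cases i <;> fin_cases j
      · change a * d * G1 (F1 (π (X (0, 0)))) = a * d * π (X (0, 0))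
        rw [ha, f1a, g1t]
        linear_combination -(b * d) * hca
      · change a * d * G1 (F1 (π (X (0, 1)))) = a * d * π (X (0, 1))
        rw [hb, f1b, map_zero]
        linear_combination -d * hba
      · change a * d * G1 (F1 (π (X (1, 0)))) = a * d * π (X (1, 0))
        rw [hc, f1c, map_zero]
        linear_combination -d * hca
      · change a * d * G1 (F1 (π (X (1, 1)))) = a * d * π (X (1, 1))
        rw [hd, f1d, g1s, Units.inv_mk]
        linear_combination -(b * d) * hca
    · refine sl2aux_ind (A := A) (S := R ⧸ I) π hπ (G2.comp F2) (-(b * c)) ?_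
      rintro ⟨i, j⟩
      fin_cases i <;> fin_cases j
      · change -(b * c) * G2 (F2 (π (X (0, 0)))) = -(b * c) * π (X (0, 0))
        rw [ha, f2a, map_zero]
        linear_combination b * hca
      · change -(b * c) * G2 (F2 (π (X (0, 1)))) = -(b * c) * π (X (0, 1))
        rw [hb, f2b, g2u]
        linear_combination -(b * d) * hca
      · change -(b * c) * G2 (F2 (π (X (1, 0)))) = -(b * c) * π (X (1, 0))
        rw [hc, f2c, g2v]
        linear_combination (b * d) * hca
      · change -(b * c) * G2 (F2 (π (X (1, 1)))) = -(b * c) * π (X (1, 1))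
        rw [hd, f2d, map_zero]
        linear_combination b * hcd
  refine ⟨AlgEquiv.ofBijective (F1.prod F2) hbij, ?_, ?_, ?_, ?_⟩
  · exact Prod.ext f1a f2a
  · exact Prod.ext f1d f2d
  · exact Prod.ext f1b f2b
  · exact Prod.ext f1c f2c
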